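/- Let α ≥ 1 and 1 < k < ∞, and let u be a nonnegative classical solution of the one-dimensional nonlocal Fisher–KPP problem with initial mass m₀ = ∫₀¹ u(0,x) dx ≥ 1. Then the function t ↦ ∫₀¹ u(t,x)^k dx is nonincreasing on [0,∞); in particular, ∫₀¹ u(t,x)^k dx ≤ ∫₀¹ u(0,x)^k dx for every t ≥ 0. -/

import Mathlib

open Set Real MeasureTheory intervalIntegral

/-- A (global) classical solution of the one-dimensional nonlocal Fisher–KPP problem
`∂ₜu = ∂ₓₓu + u^α (1 - ∫₀¹ u dy)` on `Ω = (0,1)`, with Neumann boundary conditions.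
`ut`, `ux`, `uxx` are the time derivative and the first and second spatial derivatives
of `u`; they exist on `(0,∞) × [0,1]` and are jointly continuous there, while `u`
itself is continuous on `[0,∞) × [0,1]`. -/
def IsKPPSolution (α : ℝ) (u ut ux uxx : ℝ → ℝ → ℝ) : Prop :=
  ContinuousOn (fun p : ℝ × ℝ => u p.1 p.2) (Ici 0 ×ˢ Icc 0 1) ∧
  ContinuousOn (fun p : ℝ × ℝ => ut p.1 p.2) (Ioi 0 ×ˢ Icc 0 1) ∧
  ContinuousOn (fun p : ℝ × ℝ => ux p.1 p.2) (Ioi 0 ×ˢ Icc 0 1) ∧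
  ContinuousOn (fun p : ℝ × ℝ => uxx p.1 p.2) (Ioi 0 ×ˢ Icc 0 1) ∧
  (∀ t ∈ Ioi (0:ℝ), ∀ x ∈ Icc (0:ℝ) 1, HasDerivAt (fun s => u s x) (ut t x) t) ∧
  (∀ t ∈ Ioi (0:ℝ), ∀ x ∈ Icc (0:ℝ) 1,
    HasDerivWithinAt (fun y => u t y) (ux t x) (Icc 0 1) x) ∧
  (∀ t ∈ Ioi (0:ℝ), ∀ x ∈ Icc (0:ℝ) 1,
    HasDerivWithinAt (fun y => ux t y) (uxx t x) (Icc 0 1) x) ∧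
  (∀ t ∈ Ioi (0:ℝ), ∀ x ∈ Icc (0:ℝ) 1,
    ut t x = uxx t x + u t x ^ α * (1 - ∫ y in (0:ℝ)..1, u t y)) ∧
  (∀ t ∈ Ioi (0:ℝ), ux t 0 = 0 ∧ ux t 1 = 0)

/-- Nonnegativity of a solution on `[0,∞) × [0,1]`. -/
def KPPNonneg (u : ℝ → ℝ → ℝ) : Prop :=
  ∀ t ∈ Ici (0:ℝ), ∀ x ∈ Icc (0:ℝ) 1, 0 ≤ u t x

lemma kpp_slice {F : ℝ → ℝ → ℝ} {S : Set ℝ}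
    (hF : ContinuousOn (fun p : ℝ × ℝ => F p.1 p.2) (S ×ˢ Icc 0 1)) {t : ℝ} (ht : t ∈ S) :
    ContinuousOn (fun x => F t x) (Icc 0 1) :=
  hF.comp (f := fun x : ℝ => (t, x)) (by fun_prop) (fun _ hx => ⟨ht, hx⟩)

lemma kpp_intervalIntegrable {f : ℝ → ℝ} (hf : ContinuousOn f (Icc 0 1)) :
    IntervalIntegrable f volume 0 1 :=
  ContinuousOn.intervalIntegrable (by rwa [uIcc_of_le zero_le_one])

lemma kpp_cont_integral {F : ℝ → ℝ → ℝ}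
    (hF : ContinuousOn (fun p : ℝ × ℝ => F p.1 p.2) (Ici 0 ×ˢ Icc 0 1)) :
    ContinuousOn (fun t => ∫ x in (0:ℝ)..1, F t x) (Ici 0) := by
  have h1 : Continuous (Function.uncurry
      (fun t x : ℝ => F (max t 0) (max 0 (min x 1)))) := by
    refine hF.comp_continuous (f := fun p : ℝ × ℝ => (max p.1 0, max 0 (min p.2 1)))
      (by fun_prop) ?_
    intro p
    refine ⟨mem_Ici.2 (le_max_right _ _), le_max_left _ _, max_le zero_le_one (min_le_right _ _)⟩
  have h2 := continuous_parametric_intervalIntegral_of_continuous' (μ := volume) h1 0 1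
  refine h2.continuousOn.congr ?_
  intro t ht
  refine intervalIntegral.integral_congr ?_
  intro x hx
  rw [uIcc_of_le zero_le_one] at hx
  have ht0 : (0:ℝ) ≤ t := ht
  simp only [max_eq_left ht0, min_eq_left hx.2, max_eq_right hx.1]

lemma kpp_hasDerivAt_integral {F F' : ℝ → ℝ → ℝ}
    (hF : ContinuousOn (fun p : ℝ × ℝ => F p.1 p.2) (Ici 0 ×ˢ Icc 0 1))
    (hF' : ContinuousOn (fun p : ℝ × ℝ => F' p.1 p.2) (Ioi 0 ×ˢ Icc 0 1))
    (hd : ∀ t ∈ Ioi (0:ℝ), ∀ x ∈ Icc (0:ℝ) 1, HasDerivAt (fun s => F s x) (F' t x) t)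
    {t : ℝ} (ht : 0 < t) :
    HasDerivAt (fun s => ∫ x in (0:ℝ)..1, F s x) (∫ x in (0:ℝ)..1, F' t x) t := by
  have hK : IsCompact (Icc (t/2) (2*t) ×ˢ Icc (0:ℝ) 1) := isCompact_Icc.prod isCompact_Icc
  obtain ⟨C, hC⟩ := hK.exists_bound_of_continuousOn (hF'.mono (by
    rintro ⟨s, x⟩ ⟨hs, hx⟩
    exact ⟨lt_of_lt_of_le (by linarith) hs.1, hx⟩))
  have hsub : uIoc (0:ℝ) 1 ⊆ Icc 0 1 := by
    rw [uIoc_of_le zero_le_one]; exact Ioc_subset_Icc_self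
  refine (intervalIntegral.hasDerivAt_integral_of_dominated_loc_of_deriv_le
    (μ := volume) (F := F) (F' := F') (s := Icc (t/2) (2*t)) (bound := fun _ => C)
    (Icc_mem_nhds (by linarith) (by linarith)) ?_ ?_ ?_ ?_ ?_ ?_).2
  · filter_upwards [lt_mem_nhds ht] with s hs
    exact ((kpp_slice hF (mem_Ici.2 hs.le)).mono hsub).aestronglyMeasurable measurableSet_uIoc
  · exact kpp_intervalIntegrable (kpp_slice hF (mem_Ici.2 ht.le))
  · exact ((kpp_slice hF' ht).mono hsub).aestronglyMeasurable measurableSet_uIoc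
  · exact Filter.Eventually.of_forall fun x hx s hs => hC (s, x) ⟨hs, hsub hx⟩
  · exact intervalIntegrable_const
  · exact Filter.Eventually.of_forall fun x hx s hs =>
      hd s (lt_of_lt_of_le (by linarith) hs.1 : (0:ℝ) < s) x (hsub hx)

lemma kpp_integral_deriv_zero {f f' : ℝ → ℝ}
    (hd : ∀ x ∈ Icc (0:ℝ) 1, HasDerivWithinAt f (f' x) (Icc 0 1) x)
    (hc : ContinuousOn f' (Icc 0 1)) (h0 : f 0 = 0) (h1 : f 1 = 0) :
    ∫ x in (0:ℝ)..1, f' x = 0 := by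
  rw [integral_eq_sub_of_hasDerivAt_of_le zero_le_one
    (fun x hx => (hd x hx).continuousWithinAt)
    (fun x hx => (hd x (Ioo_subset_Icc_self hx)).hasDerivAt (Icc_mem_nhds hx.1 hx.2))
    (kpp_intervalIntegrable hc), h0, h1, sub_zero]

lemma kpp_mass_ge_one {α : ℝ} (hα : 1 ≤ α) {u ut ux uxx : ℝ → ℝ → ℝ}
    (hsol : IsKPPSolution α u ut ux uxx) (hnonneg : KPPNonneg u)
    (hm₀ : 1 ≤ ∫ x in (0:ℝ)..1, u 0 x) {t : ℝ} (ht : 0 ≤ t) :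
    1 ≤ ∫ x in (0:ℝ)..1, u t x := by
  obtain ⟨cu, cut, cux, cuxx, dt, dx, dxx, heq, hbc⟩ := hsol
  have hcont := kpp_cont_integral cu
  have hder : ∀ s : ℝ, 0 < s → HasDerivAt (fun s => ∫ x in (0:ℝ)..1, u s x)
      (∫ x in (0:ℝ)..1, ut s x) s := fun s hs => kpp_hasDerivAt_integral cu cut dt hs
  by_contra hlt
  push Not at hlt
  have hcompact : IsCompact (Icc 0 t ∩ (fun s => ∫ x in (0:ℝ)..1, u s x) ⁻¹' Ici 1) := by
    refine isCompact_Icc.of_isClosed_subset ?_ inter_subset_left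
    exact (hcont.mono Icc_subset_Ici_self).preimage_isClosed_of_isClosed isClosed_Icc isClosed_Ici
  obtain ⟨s, ⟨hs, hs1⟩, hmax⟩ := hcompact.exists_isGreatest ⟨0, ⟨le_rfl, ht⟩, hm₀⟩
  have hs1' : 1 ≤ ∫ x in (0:ℝ)..1, u s x := hs1
  have hmono : MonotoneOn (fun s => ∫ x in (0:ℝ)..1, u s x) (Icc s t) := by
    refine monotoneOn_of_deriv_nonneg (convex_Icc s t)
      (hcont.mono fun r hr => le_trans hs.1 hr.1) ?_ ?_
    · intro r hr
      rw [interior_Icc] at hr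
      exact (hder r (lt_of_le_of_lt hs.1 hr.1)).differentiableAt.differentiableWithinAt
    · intro r hr
      rw [interior_Icc] at hr
      have hr0 : 0 < r := lt_of_le_of_lt hs.1 hr.1
      have hr1 : ∫ x in (0:ℝ)..1, u r x < 1 := by
        by_contra hcon
        push Not at hcon
        exact absurd (hmax ⟨⟨hr0.le, hr.2.le⟩, hcon⟩) (not_le.2 hr.1)
      rw [(hder r hr0).deriv]
      have hz : ∫ x in (0:ℝ)..1, uxx r x = 0 :=
        kpp_integral_deriv_zero (dxx r hr0) (kpp_slice cuxx hr0) (hbc r hr0).1 (hbc r hr0).2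
      refine hz.ge.trans ?_
      refine intervalIntegral.integral_mono_on zero_le_one
        (kpp_intervalIntegrable (kpp_slice cuxx hr0)) (kpp_intervalIntegrable (kpp_slice cut hr0)) ?_
      intro x hx
      rw [heq r hr0 x hx]
      have := mul_nonneg (rpow_nonneg (hnonneg r hr0.le x hx) α) (sub_nonneg.2 hr1.le)
      linarith
  have := hmono (left_mem_Icc.2 hs.2) (right_mem_Icc.2 hs.2) hs.2
  simp only at this
  linarith

lemma kpp_reg_antitone {α k ε : ℝ} (hα : 1 ≤ α) (hk : 1 < k) (hε : 0 < ε)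
    {u ut ux uxx : ℝ → ℝ → ℝ}
    (hsol : IsKPPSolution α u ut ux uxx) (hnonneg : KPPNonneg u)
    (hm₀ : 1 ≤ ∫ x in (0:ℝ)..1, u 0 x) :
    AntitoneOn (fun t => ∫ x in (0:ℝ)..1, (u t x + ε) ^ k) (Ici 0) := by
  have hm : ∀ t : ℝ, 0 ≤ t → 1 ≤ ∫ x in (0:ℝ)..1, u t x :=
    fun t ht => kpp_mass_ge_one hα hsol hnonneg hm₀ ht
  obtain ⟨cu, cut, cux, cuxx, dt, dx, dxx, heq, hbc⟩ := hsol
  have hpos : ∀ t : ℝ, 0 ≤ t → ∀ x ∈ Icc (0:ℝ) 1, 0 < u t x + ε :=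
    fun t ht x hx => add_pos_of_nonneg_of_pos (hnonneg t ht x hx) hε
  have cpow : ∀ q : ℝ, ContinuousOn (fun p : ℝ × ℝ => (u p.1 p.2 + ε) ^ q)
      (Ici 0 ×ˢ Icc 0 1) := fun q =>
    (cu.add continuousOn_const).rpow_const
      fun p hp => Or.inl (hpos p.1 hp.1 p.2 hp.2).ne'
  have hsub : Ioi (0:ℝ) ×ˢ Icc (0:ℝ) 1 ⊆ Ici 0 ×ˢ Icc 0 1 :=
    prod_mono Ioi_subset_Ici_self subset_rfl
  have cF' : ContinuousOn (fun p : ℝ × ℝ => ut p.1 p.2 * k * (u p.1 p.2 + ε) ^ (k - 1))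
      (Ioi 0 ×ˢ Icc 0 1) := (cut.mul continuousOn_const).mul ((cpow (k-1)).mono hsub)
  have hder : ∀ t : ℝ, 0 < t → HasDerivAt (fun t => ∫ x in (0:ℝ)..1, (u t x + ε) ^ k)
      (∫ x in (0:ℝ)..1, ut t x * k * (u t x + ε) ^ (k - 1)) t := by
    intro t ht
    refine kpp_hasDerivAt_integral (F := fun t x => (u t x + ε) ^ k)
      (F' := fun t x => ut t x * k * (u t x + ε) ^ (k - 1)) (cpow k) cF' ?_ ht
    intro s hs x hx
    exact ((dt s hs x hx).add_const ε).rpow_const (Or.inr hk.le)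
  refine antitoneOn_of_deriv_nonpos (convex_Ici 0)
    (kpp_cont_integral (F := fun t x => (u t x + ε) ^ k) (cpow k)) ?_ ?_
  · intro t ht
    rw [interior_Ici] at ht
    exact (hder t ht).differentiableAt.differentiableWithinAt
  · intro t ht
    rw [interior_Ici] at ht
    have ht0 : (0:ℝ) < t := ht
    rw [(hder t ht).deriv]
    have cu' := fun q : ℝ => kpp_slice (F := fun t x => (u t x + ε) ^ q) (cpow q)
      (mem_Ici.2 ht0.le)
    have cW : ContinuousOn (fun x => k * ((ux t x * (k - 1) * (u t x + ε) ^ (k - 1 - 1)) * ux t x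
        + (u t x + ε) ^ (k - 1) * uxx t x)) (Icc 0 1) := by
      have a := kpp_slice cux ht
      have b := kpp_slice cuxx ht
      exact continuousOn_const.mul ((((a.mul continuousOn_const).mul (cu' (k-1-1))).mul a).add
        ((cu' (k-1)).mul b))
    have hz := kpp_integral_deriv_zero (f := fun x => k * ((u t x + ε) ^ (k - 1) * ux t x))
      (fun x hx => ((((dx t ht x hx).add_const ε).rpow_const
        (Or.inl (hpos t ht0.le x hx).ne')).mul (dxx t ht x hx)).const_mul k) cW
      (by simp [(hbc t ht).1]) (by simp [(hbc t ht).2])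
    refine le_trans ?_ hz.le
    refine intervalIntegral.integral_mono_on zero_le_one
      (kpp_intervalIntegrable (kpp_slice
        (F := fun t x => ut t x * k * (u t x + ε) ^ (k - 1)) cF' ht))
      (kpp_intervalIntegrable cW) ?_
    intro x hx
    rw [heq t ht x hx]
    have hp := hpos t ht0.le x hx
    have h1 : 0 ≤ (u t x + ε) ^ (k - 1) := rpow_nonneg hp.le _
    have h2 : 0 ≤ (u t x + ε) ^ (k - 1 - 1) := rpow_nonneg hp.le _
    have h3 : 0 ≤ u t x ^ α := rpow_nonneg (hnonneg t ht0.le x hx) α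
    have h4 := hm t ht0.le
    have hk0 : 0 < k := by linarith
    have h5 : 0 ≤ k * (u t x + ε) ^ (k - 1) * (u t x ^ α * ((∫ y in (0:ℝ)..1, u t y) - 1)) :=
      mul_nonneg (mul_nonneg hk0.le h1) (mul_nonneg h3 (sub_nonneg.2 h4))
    have h6 : 0 ≤ k * ((k - 1) * (u t x + ε) ^ (k - 1 - 1) * (ux t x * ux t x)) :=
      mul_nonneg hk0.le (mul_nonneg (mul_nonneg (by linarith) h2) (mul_self_nonneg _))
    nlinarith [h5, h6]

/-- **Monotonicity of the `L^k` norm, supercritical mass.**  For `α ≥ 1`, `k > 1` and a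
nonnegative classical solution with initial mass `m₀ ≥ 1`, the function
`t ↦ ∫₀¹ u(t,x)^k dx` is nonincreasing on `[0,∞)`; in particular it is bounded by its
initial value. -/
theorem Lk_nonincreasing (α k : ℝ) (hα : 1 ≤ α) (hk : 1 < k)
    (u ut ux uxx : ℝ → ℝ → ℝ)
    (hsol : IsKPPSolution α u ut ux uxx) (hnonneg : KPPNonneg u)
    (hm₀ : 1 ≤ ∫ x in (0:ℝ)..1, u 0 x) :
    AntitoneOn (fun t => ∫ x in (0:ℝ)..1, u t x ^ k) (Ici 0) ∧
      ∀ t ∈ Ici (0:ℝ), (∫ x in (0:ℝ)..1, u t x ^ k) ≤ ∫ x in (0:ℝ)..1, u 0 x ^ k := by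
  have hanti : AntitoneOn (fun t => ∫ x in (0:ℝ)..1, u t x ^ k) (Ici 0) := by
    intro s hs t ht hst
    have hG : ∀ r ∈ Ici (0:ℝ), ContinuousWithinAt
        (fun ε => ∫ x in (0:ℝ)..1, (u r x + ε) ^ k) (Ioi 0) 0 := by
      intro r hr
      have hc : ContinuousOn (fun x => u r x) (Icc 0 1) := kpp_slice hsol.1 hr
      have h := kpp_cont_integral (F := fun ε x => (u r x + ε) ^ k) (by
        refine ContinuousOn.rpow_const ?_ (fun _ _ => Or.inr (by linarith))
        refine ContinuousOn.add ?_ continuousOn_fst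
        exact hc.comp continuousOn_snd (fun p hp => hp.2))
      exact (h 0 (mem_Ici.2 le_rfl)).mono Ioi_subset_Ici_self
    have h0 := ContinuousWithinAt.closure_le (by simp) (hG t ht) (hG s hs)
      (fun ε hε => kpp_reg_antitone hα hk hε hsol hnonneg hm₀ hs ht hst)
    simpa using h0
  exact ⟨hanti, fun t ht => hanti (mem_Ici.2 le_rfl) ht ht⟩
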